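/- For every prime p and all integers N ≥ 0, n ≥ 0, s ≥ 1, the group cohomology of the free abelian group ℤ^N with coefficients in ℤ/p^sℤ equipped with the trivial action satisfies H^n(ℤ^N, ℤ/p^sℤ) ≅ Hom_ℤ(Λ^n_ℤ(ℤ^N), ℤ/p^sℤ), where Λ^n_ℤ denotes the n-th exterior power over ℤ. -/

import Mathlib

section

open CategoryTheory Limits

namespace Rep

universe u

variable {k G : Type u} [CommRing k]

lemma exact_of_forall_exists [Monoid G] (X : ShortComplex (Rep.{u} k G))
    (h : ∀ x : X.X₂, X.g.hom x = 0 → ∃ y : X.X₁, X.f.hom y = x) : X.Exact := by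
  rw [← ShortComplex.exact_map_iff_of_faithful X (forget₂ (Rep.{u} k G) (ModuleCat k)),
    ShortComplex.moduleCat_exact_iff]
  exact h

end Rep

namespace groupCohomology

universe u

variable {k G : Type u} [CommRing k]

instance [Group G] : (cochainsFunctor k G).Additive where
  map_add := rfl

instance [Group G] (n : ℕ) : (functor k G n).Additive :=
  inferInstanceAs (cochainsFunctor k G ⋙ HomologicalComplex.homologyFunctor _ _ n).Additive

/-- Elements of a commutative group act trivially on its cohomology. -/
theorem map_applyAsHom [CommGroup G] (g : G) (n : ℕ) (A : Rep.{u} k G) :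
    map (.id G) (A.applyAsHom g) n = 𝟙 (groupCohomology A n) := by
  induction n generalizing A with
  | zero =>
    rw [← cancel_mono (H0Iso A).hom]
    have := map_id_comp_H0Iso_hom (A.applyAsHom g)
    refine this.trans ?_
    have h : (Rep.invariantsFunctor k G).map (A.applyAsHom g) = 𝟙 _ := by
      ext x
      exact Subtype.ext (x.2 g)
    rw [h]
    exact (Category.comp_id _).trans (Category.id_comp _).symm
  | succ n ih =>
    let I := Rep.coind (⊥ : Subgroup G).subtype (Rep.res (⊥ : Subgroup G).subtype A)
    let i : A ⟶ I := Rep.resCoindToHom (⊥ : Subgroup G).subtype A _ (𝟙 _)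
    have hi : Mono i := by
      rw [Rep.mono_iff_injective]
      intro x y hxy
      have : A.ρ 1 x = A.ρ 1 y := congrFun (congrArg Subtype.val hxy) 1
      simpa using this
    let X : ShortComplex (Rep.{u} k G) := ShortComplex.mk i (cokernel.π i) (by simp)
    have hX : X.ShortExact := { exact := ShortComplex.exact_cokernel i }
    let F : X ⟶ X := ⟨A.applyAsHom g, I.applyAsHom g, Rep.applyAsHom _ g,
      Rep.applyAsHom_comm _ _, Rep.applyAsHom_comm _ _⟩
    have := epi_δ_of_isZero hX n
      ((isZero_groupCohomology_succ_of_subsingleton _ n).of_iso (coindIso _ (n + 1)))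
    rw [← cancel_epi (δ hX n (n + 1) rfl)]
    refine (δ_naturality hX hX F n (n + 1) rfl).trans ?_
    have h2 := ih (X.X₃)
    exact (congrArg (· ≫ δ hX n (n + 1) rfl) h2).trans
      ((Category.id_comp _).trans (Category.comp_id _).symm)

/-- If the second map of a short exact sequence of representations vanishes on cohomology, the
long exact sequence breaks up into short exact sequences. -/
theorem exists_exact_of_map_eq_zero [Group G] {X : ShortComplex (Rep.{u} k G)} (hX : X.ShortExact)
    (hg : ∀ i, (functor k G i).map X.g = 0) (n : ℕ) :
    ∃ (f : groupCohomology X.X₃ n →ₗ[k] groupCohomology X.X₁ (n + 1))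
      (g : groupCohomology X.X₁ (n + 1) →ₗ[k] groupCohomology X.X₂ (n + 1)),
      Function.Injective f ∧ Function.Surjective g ∧ Function.Exact f g :=
  ⟨(δ hX n (n + 1) rfl).hom, (map (.id G) X.f (n + 1)).hom,
    (ModuleCat.mono_iff_injective _).1 ((mapShortComplex₃_exact hX rfl).mono_g (hg n)),
    (ModuleCat.epi_iff_surjective _).1 ((mapShortComplex₂_exact hX (n + 1)).epi_f (hg _)),
    (ShortComplex.ShortExact.moduleCat_exact_iff_function_exact _).1
      (mapShortComplex₁_exact hX rfl)⟩

end groupCohomology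

/-- Every integer-indexed family is a family of consecutive differences. -/
lemma exists_forall_add_one_sub_eq {A : Type*} [AddCommGroup A] (f : ℤ → A) :
    ∃ h : ℤ → A, ∀ n, h (n + 1) - h n = f n := by
  refine ⟨fun n => ∑ i ∈ Finset.Ico 0 n, f i - ∑ i ∈ Finset.Ico n 0, f i, fun n => ?_⟩
  beta_reduce
  rcases lt_or_ge n 0 with hn | hn
  · rw [Finset.Ico_eq_empty_of_le (a := 0) (b := n) hn.le,
      Finset.Ico_eq_empty_of_le (a := 0) (b := n + 1) (by omega),
      ← Finset.insert_Ico_add_one_left_eq_Ico hn]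
    simp
  · rw [Finset.Ico_eq_empty_of_le (a := n) (b := 0) hn,
      Finset.Ico_eq_empty_of_le (a := n + 1) (b := 0) (by omega),
      ← Finset.insert_Ico_right_eq_Ico_add_one hn]
    simp

namespace InfiniteCyclicQuotient

universe u

variable {k G : Type u} [CommRing k] [CommGroup G] (φ : G →* Multiplicative ℤ) (t : G)
  (A : Type u) [AddCommGroup A] [Module k A]

/-- The trivial representation of `φ.ker` on `A`, coinduced to `G`. -/
noncomputable abbrev coindKer : Rep.{u} k G := Rep.coind φ.ker.subtype (Rep.trivial k φ.ker A)

/-- The inclusion of `A` into the coinduced representation as the constant functions. -/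
noncomputable def toCoindKer : Rep.trivial k G A ⟶ coindKer (k := k) φ A :=
  Rep.resCoindToHom φ.ker.subtype (Rep.trivial k G A) (Rep.trivial k φ.ker A) (𝟙 _)

/-- The sequence `A ⟶ coind A ⟶ coind A` whose second map is `t - 1`. -/
noncomputable abbrev complex : ShortComplex (Rep.{u} k G) :=
  ShortComplex.mk (toCoindKer (k := k) φ A) ((coindKer (k := k) φ A).applyAsHom t - 𝟙 _) (by
    ext a g; exact sub_self a)

variable {φ t}

lemma eq_of_map_eq (f : coindKer (k := k) φ A) {g h : G} (e : φ g = φ h) : f.1 g = f.1 h := by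
  have := f.2 ⟨g * h⁻¹, by simp [MonoidHom.mem_ker, e]⟩ h
  simpa using this

lemma complex_shortExact (ht : φ t = Multiplicative.ofAdd 1) :
    (complex (k := k) φ t A).ShortExact where
  exact := by
    refine Rep.exact_of_forall_exists _ fun (x : coindKer (k := k) φ A) hx => ⟨x.1 1, ?_⟩
    have h1 (g : G) : x.1 (g * t) = x.1 g := by
      have := congrFun (congrArg Subtype.val hx) g
      exact sub_eq_zero.1 this
    have h2 (n : ℤ) : x.1 (t ^ n) = x.1 1 := by
      induction n with
      | zero => simp
      | succ n ih => rw [zpow_add_one, h1, ih]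
      | pred n ih => rw [← ih, ← h1, ← zpow_add_one]; simp
    apply Subtype.ext; funext g
    change x.1 1 = x.1 g
    rw [← h2 (φ g).toAdd]
    apply eq_of_map_eq A
    rw [map_zpow, ht, ← ofAdd_zsmul]; simp
  mono_f := by
    rw [Rep.mono_iff_injective]
    intro a b h
    exact congrFun (congrArg Subtype.val h) 1
  epi_g := by
    rw [Rep.epi_iff_surjective]
    intro (f : coindKer (k := k) φ A)
    obtain ⟨h, hh⟩ := exists_forall_add_one_sub_eq fun n => f.1 (t ^ n)
    refine ⟨⟨fun g => h (φ g).toAdd, fun s g => ?_⟩, ?_⟩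
    · have : φ s.1 = 1 := s.2
      simp [this]
    · apply Subtype.ext; funext g
      change h (φ (g * t)).toAdd - h (φ g).toAdd = f.1 g
      rw [map_mul, ht]
      refine (hh _).trans ?_
      apply eq_of_map_eq A
      rw [map_zpow, ht, ← ofAdd_zsmul]; simp

open groupCohomology in
/-- If `φ : G →* ℤ` maps `t` to the generator, there are short exact sequences
`0 → Hⁿ(ker φ, A) → Hⁿ⁺¹(G, A) → Hⁿ⁺¹(ker φ, A) → 0`. -/
theorem exists_exact (ht : φ t = Multiplicative.ofAdd 1) (n : ℕ) :
    ∃ (f : groupCohomology (Rep.trivial k φ.ker A) n →ₗ[k]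
        groupCohomology (Rep.trivial k G A) (n + 1))
      (g : groupCohomology (Rep.trivial k G A) (n + 1) →ₗ[k]
        groupCohomology (Rep.trivial k φ.ker A) (n + 1)),
      Function.Injective f ∧ Function.Surjective g ∧ Function.Exact f g := by
  have hg (i : ℕ) : (functor k G i).map ((coindKer (k := k) φ A).applyAsHom t - 𝟙 _) = 0 := by
    rw [Functor.map_sub, CategoryTheory.Functor.map_id, sub_eq_zero]
    exact map_applyAsHom ..
  obtain ⟨f, g, hf, hg, hfg⟩ :=
    exists_exact_of_map_eq_zero (complex_shortExact (k := k) A ht) hg n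
  have e (i : ℕ) : groupCohomology (coindKer (k := k) φ A) i ≃ₗ[k]
      groupCohomology (Rep.trivial k φ.ker A) i :=
    (coindIso (Rep.trivial k φ.ker A) i).toLinearEquiv
  refine ⟨f.comp (e n).symm.toLinearMap, (e (n + 1)).toLinearMap.comp g, ?_, ?_, ?_⟩
  · exact hf.comp (e n).symm.injective
  · exact (e (n + 1)).surjective.comp hg
  · intro x
    exact (LinearEquiv.map_eq_zero_iff (e (n + 1))).trans
      ((hfg x).trans ((e n).symm.surjective.exists (p := fun y => f y = x)))

end InfiniteCyclicQuotient

lemma nonempty_linearEquiv_of_exact {R M : Type*} {a b : ℕ} [CommRing R] [AddCommGroup M]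
    [Module R M] {f : (Fin a → R) →ₗ[R] M} {g : M →ₗ[R] (Fin b → R)}
    (hf : Function.Injective f) (hg : Function.Surjective g) (hfg : Function.Exact f g) :
    Nonempty (M ≃ₗ[R] (Fin (a + b) → R)) := by
  obtain ⟨l, hl⟩ := Module.projective_lifting_property g .id hg
  obtain ⟨e, -⟩ := hfg.splitSurjectiveEquiv hf ⟨l, hl⟩
  exact ⟨e.trans ((LinearEquiv.sumArrowLequivProdArrow _ _ R R).symm.trans
    (LinearEquiv.funCongrLeft _ _ finSumFinEquiv.symm))⟩

lemma nonempty_addEquiv_of_exact {m a b : ℕ} {M M₁ M₂ : Type*} [AddCommGroup M] [AddCommGroup M₁]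
    [AddCommGroup M₂] (hM : ∀ x : M, m • x = 0) {f : M₁ →+ M} {g : M →+ M₂}
    (hf : Function.Injective f) (hg : Function.Surjective g) (hfg : Function.Exact f g)
    (e₁ : M₁ ≃+ (Fin a → ZMod m)) (e₂ : M₂ ≃+ (Fin b → ZMod m)) :
    Nonempty (M ≃+ (Fin (a + b) → ZMod m)) := by
  let : Module (ZMod m) M := AddCommGroup.zmodModule hM
  refine (nonempty_linearEquiv_of_exact
    (f := (f.comp e₁.symm.toAddMonoidHom).toZModLinearMap m)
    (g := (e₂.toAddMonoidHom.comp g).toZModLinearMap m)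
    (hf.comp e₁.symm.injective) (e₂.surjective.comp hg) fun x => ?_).map LinearEquiv.toAddEquiv
  exact (map_eq_zero_iff e₂ e₂.injective).trans
    ((hfg x).trans (e₁.symm.surjective.exists (p := fun y => f y = x)))

lemma nsmul_groupCohomology_trivial_eq_zero {G : Type} [Group G] (m n : ℕ)
    (x : groupCohomology (Rep.trivial ℤ G (ZMod m)) n) : m • x = 0 := by
  have h : m • 𝟙 (Rep.trivial ℤ G (ZMod m)) = 0 := by
    ext (y : ZMod m)
    change m • y = 0
    simp
  have h2 := congrArg (groupCohomology.functor ℤ G n).map h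
  rw [Functor.map_nsmul, CategoryTheory.Functor.map_id, Functor.map_zero] at h2
  exact LinearMap.congr_fun (congrArg ModuleCat.Hom.hom h2) x

/-- The kernel of the first coordinate on `ℤ^(N+1)` is `ℤ^N`. -/
def kerEvalZeroEquiv (N : ℕ) :
    (AddMonoidHom.toMultiplicative (Pi.evalAddMonoidHom (fun _ : Fin (N + 1) => ℤ) 0)).ker ≃*
      Multiplicative (Fin N → ℤ) where
  toFun x := .ofAdd (Fin.tail x.1.toAdd)
  invFun y := ⟨.ofAdd (Fin.cons 0 y.toAdd), rfl⟩
  left_inv x := by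
    apply Subtype.ext
    have h : x.1.toAdd 0 = 0 := x.2
    change Multiplicative.ofAdd (Fin.cons 0 (Fin.tail x.1.toAdd)) = x.1
    rw [← h, Fin.cons_self_tail]; rfl
  right_inv y := rfl
  map_mul' x y := rfl

theorem nonempty_groupCohomology_addEquiv (m N n : ℕ) :
    Nonempty (groupCohomology (Rep.trivial ℤ (Multiplicative (Fin N → ℤ)) (ZMod m)) n ≃+
      (Fin (N.choose n) → ZMod m)) := by
  induction N generalizing n with
  | zero =>
    cases n with
    | zero =>
      exact ⟨(groupCohomology.H0IsoOfIsTrivial _).toLinearEquiv.toAddEquiv.trans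
        (LinearEquiv.funUnique (Fin 1) ℤ (ZMod m)).symm.toAddEquiv⟩
    | succ n =>
      have : Subsingleton (groupCohomology
          (Rep.trivial ℤ (Multiplicative (Fin 0 → ℤ)) (ZMod m)) (n + 1)) :=
        ModuleCat.subsingleton_of_isZero (isZero_groupCohomology_succ_of_subsingleton _ n)
      rw [Nat.choose_zero_succ]
      exact ⟨⟨@Equiv.ofUnique _ _ (uniqueOfSubsingleton 0) _, fun _ _ => Subsingleton.elim _ _⟩⟩
  | succ N ih =>
    cases n with
    | zero =>
      rw [Nat.choose_zero_right]
      exact ⟨(groupCohomology.H0IsoOfIsTrivial _).toLinearEquiv.toAddEquiv.trans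
        (LinearEquiv.funUnique (Fin 1) ℤ (ZMod m)).symm.toAddEquiv⟩
    | succ n =>
      obtain ⟨f, g, hf, hg, hfg⟩ := InfiniteCyclicQuotient.exists_exact (k := ℤ)
        (φ := AddMonoidHom.toMultiplicative (Pi.evalAddMonoidHom (fun _ : Fin (N + 1) => ℤ) 0))
        (t := .ofAdd (Pi.single 0 1)) (ZMod m) (by simp) n
      let e (i : ℕ) := (groupCohomology.mapIso (B := Rep.trivial ℤ _ (ZMod m))
        (A := Rep.trivial ℤ _ (ZMod m)) (kerEvalZeroEquiv N) (.refl ℤ _)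
        (fun _ => rfl) i).toLinearEquiv.toAddEquiv
      obtain ⟨e₁⟩ := ih n
      obtain ⟨e₂⟩ := ih (n + 1)
      rw [Nat.choose_succ_succ]
      exact nonempty_addEquiv_of_exact (nsmul_groupCohomology_trivial_eq_zero m _)
        (f := f.toAddMonoidHom) (g := g.toAddMonoidHom) hf hg hfg
        ((e n).trans e₁) ((e (n + 1)).trans e₂)

end

/-- For every prime `p` and all integers `N ≥ 0`, `n ≥ 0`, `s ≥ 1`, the group
cohomology of the free abelian group `ℤ^N` with coefficients in `ℤ/p^sℤ` (trivial action)
satisfies `H^n(ℤ^N, ℤ/p^sℤ) ≅ Hom_ℤ(Λ^n_ℤ(ℤ^N), ℤ/p^sℤ)`. -/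
theorem stmt_0 (p : ℕ) (hp : p.Prime) (N n s : ℕ) (hs : 1 ≤ s) :
    Nonempty
      ((groupCohomology (Rep.trivial ℤ (Multiplicative (Fin N → ℤ)) (ZMod (p ^ s))) n) ≃ₗ[ℤ]
        ((⋀[ℤ]^n (Fin N → ℤ)) →ₗ[ℤ] ZMod (p ^ s))) := by
  obtain ⟨e⟩ := nonempty_groupCohomology_addEquiv (p ^ s) N n
  let b := Module.finBasisOfFinrankEq ℤ (⋀[ℤ]^n (Fin N → ℤ))
    ((exteriorPower.finrank_eq ℤ n).trans (by rw [Module.finrank_fin_fun]))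
  exact ⟨e.toIntLinearEquiv.trans (b.constr ℤ)⟩
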